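/- Let R be a Noetherian commutative ring and k ∈ ℕ, with R[X] and its Sym(ℕ)- and Inc(ℕ)-actions as in the context. Let u₁,…,u_r be monomials in R[X] and let T be the R-subalgebra of R[X] generated by the union of the Sym(ℕ)-orbits of u₁,…,u_r. Then T is stable under the Inc(ℕ)-action on R[X], and T is Inc(ℕ)-Noetherian: every Inc(ℕ)-stable ideal of T is generated by the union of finitely many Inc(ℕ)-orbits of its elements. -/

import Mathlib

namespace MvPolynomial

theorem degree_rename_le {σ R : Type*} [CommRing R] (ord : MonomialOrder σ) {g : σ → σ}
    (hord : ∀ a b, ord.toSyn a < ord.toSyn b →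
      ord.toSyn (a.mapDomain g) < ord.toSyn (b.mapDomain g)) (f : MvPolynomial σ R) :
    ord.toSyn (ord.degree (rename g f)) ≤ ord.toSyn ((ord.degree f).mapDomain g) := by
  classical
  rw [ord.degree_le_iff]
  intro c hc
  obtain ⟨b, rfl, hb⟩ := coeff_rename_ne_zero _ _ _ (mem_support_iff.1 hc)
  rcases (ord.le_degree (mem_support_iff.2 hb)).lt_or_eq with h | h
  · exact (hord _ _ h).le
  · rw [ord.toSyn.injective h]

/-- A cancellation step: if the leading coefficient of `f` is a linear combination of leading
coefficients of `h i`, and the leading exponent of `f` is obtained from that of each `h i` by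
applying `g i` and adding `c i`, then the corresponding combination of the shifted `h i` has the
same leading term as `f`. -/
theorem toSyn_degree_sub_sum_lt {σ R ι : Type*} [CommRing R] [Fintype ι] (ord : MonomialOrder σ)
    {f : MvPolynomial σ R} (h : ι → MvPolynomial σ R) (r : ι → R) (g : ι → σ → σ)
    (c : ι → σ →₀ ℕ) (hinj : ∀ i, Function.Injective (g i))
    (hord : ∀ i a b, ord.toSyn a < ord.toSyn b →
      ord.toSyn (a.mapDomain (g i)) < ord.toSyn (b.mapDomain (g i)))
    (hdeg : ∀ i, ord.degree f = (ord.degree (h i)).mapDomain (g i) + c i)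
    (hlc : ord.leadingCoeff f = ∑ i, r i * ord.leadingCoeff (h i))
    (hne : f - ∑ i, monomial (c i) (r i) * rename (g i) (h i) ≠ 0) :
    ord.toSyn (ord.degree (f - ∑ i, monomial (c i) (r i) * rename (g i) (h i))) <
      ord.toSyn (ord.degree f) := by
  refine lt_of_le_of_ne ?_ fun heq => ?_
  · refine ord.degree_sub_le.trans (max_le le_rfl ?_)
    refine ord.degree_sum_le.trans (Finset.sup_le fun i _ => ?_)
    refine ord.degree_mul_le.trans ?_
    rw [hdeg i, add_comm (Finsupp.mapDomain _ _), map_add, map_add]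
    exact add_le_add (ord.degree_monomial_le _) (degree_rename_le ord (hord i) _)
  · refine ord.coeff_degree_ne_zero_iff.2 hne ?_
    rw [ord.toSyn.injective heq, coeff_sub, coeff_sum, sub_eq_zero]
    refine hlc.trans (Finset.sum_congr rfl fun i _ => ?_)
    rw [hdeg i, add_comm, coeff_monomial_mul, coeff_rename_mapDomain _ (hinj i)]
    rfl

/-- **Equivariant Hilbert basis theorem** for monomial subalgebras: if the exponent monoid `M` is
well-quasi-ordered by divisibility up to a set `G` of injections compatible with a monomial order,
then each `G`-stable ideal of the corresponding subalgebra is generated by finitely many orbits. -/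
theorem exists_finset_eq_span_orbits {σ R : Type*} [CommRing R] [IsNoetherianRing R]
    (ord : MonomialOrder σ) (M : AddSubmonoid (σ →₀ ℕ)) (T : Subalgebra R (MvPolynomial σ R))
    (hT : ∀ f, f ∈ T ↔ ∀ m ∈ f.support, m ∈ M) (G : Set (σ → σ))
    (hinj : ∀ g ∈ G, Function.Injective g)
    (hord : ∀ g ∈ G, ∀ a b, ord.toSyn a < ord.toSyn b →
      ord.toSyn (a.mapDomain g) < ord.toSyn (b.mapDomain g))
    (hstab : ∀ g ∈ G, ∀ f ∈ T, rename g f ∈ T)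
    (hwqo : ∀ a : ℕ → σ →₀ ℕ, (∀ n, a n ∈ M) → ∃ φ : ℕ → ℕ, StrictMono φ ∧
      ∀ i j, i < j → ∃ g ∈ G, ∃ c ∈ M, a (φ j) = (a (φ i)).mapDomain g + c)
    (I : Ideal T)
    (hI : ∀ g ∈ G, ∀ x ∈ I, ∀ y : T, (y : MvPolynomial σ R) = rename g x → y ∈ I) :
    ∃ F : Finset T, (↑F : Set T) ⊆ (I : Set T) ∧
      I = Ideal.span {y : T | ∃ f ∈ F, ∃ g ∈ G, (y : MvPolynomial σ R) = rename g f} := by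
  classical
  by_contra! hcon
  let J : Finset T → Ideal T := fun F =>
    Ideal.span {y : T | ∃ f ∈ F, ∃ g ∈ G, (y : MvPolynomial σ R) = rename g f}
  let deg : T → ord.syn := fun f => ord.toSyn (ord.degree (f : MvPolynomial σ R))
  have hJI : ∀ F : Finset T, (↑F : Set T) ⊆ (I : Set T) → J F ≤ I := by
    intro F hF
    refine Ideal.span_le.2 ?_
    rintro y ⟨f, hf, g, hg, hy⟩
    exact hI g hg f (hF hf) y hy
  have hnext : ∀ F : Finset T, ∃ f : T, (↑F : Set T) ⊆ (I : Set T) →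
      f ∈ I ∧ f ∉ J F ∧ ∀ x ∈ I, x ∉ J F → ¬ deg x < deg f := by
    intro F
    by_cases hF : (↑F : Set T) ⊆ (I : Set T)
    · have hne : ∃ f ∈ I, f ∉ J F := by
        by_contra! hle
        exact hcon F hF (le_antisymm hle (hJI F hF))
      obtain ⟨f, hf⟩ := hne
      obtain ⟨f, hf, hmin⟩ := (InvImage.wf deg ord.wellFoundedLT_syn.wf).has_min
        {f : T | f ∈ I ∧ f ∉ J F} ⟨f, hf⟩
      exact ⟨f, fun _ => ⟨hf.1, hf.2, fun x hx hxJ => hmin x ⟨hx, hxJ⟩⟩⟩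
    · exact ⟨0, fun h => absurd h hF⟩
  choose next hnext using hnext
  let S : ℕ → Finset T := fun n =>
    Nat.rec (motive := fun _ => Finset T) ∅ (fun _ F => insert (next F) F) n
  have hSsucc : ∀ n, S (n + 1) = insert (next (S n)) (S n) := fun _ => rfl
  have hSI : ∀ n, (↑(S n) : Set T) ⊆ (I : Set T) := by
    intro n
    induction n with
    | zero => simp [S]
    | succ n ih =>
      rw [hSsucc, Finset.coe_insert]
      exact Set.insert_subset (hnext _ ih).1 ih
  let f : ℕ → T := fun n => next (S n)
  have hfI : ∀ n, f n ∈ I := fun n => (hnext _ (hSI n)).1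
  have hfJ : ∀ n, f n ∉ J (S n) := fun n => (hnext _ (hSI n)).2.1
  have hfmin : ∀ n, ∀ x ∈ I, x ∉ J (S n) → ¬ deg x < deg (f n) :=
    fun n => (hnext _ (hSI n)).2.2
  have hSmono : Monotone S := monotone_nat_of_le_succ fun n => by
    rw [hSsucc]; exact Finset.subset_insert _ _
  have hfS : ∀ m n, m < n → f m ∈ S n := fun m n hmn =>
    hSmono (Nat.succ_le_of_lt hmn) (by rw [hSsucc]; exact Finset.mem_insert_self _ _)
  have hf0 : ∀ n, (f n : MvPolynomial σ R) ≠ 0 := by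
    intro n h
    apply hfJ n
    rw [show f n = 0 from Subtype.ext h]
    exact zero_mem _
  obtain ⟨φ, hφ, hdiv⟩ := hwqo (fun n => ord.degree (f n : MvPolynomial σ R))
    fun n => (hT _).1 (f n).2 _ (ord.degree_mem_support (hf0 n))
  let lc : ℕ → R := fun n => ord.leadingCoeff (f (φ n) : MvPolynomial σ R)
  let K : ℕ →o Ideal R := ⟨fun n => Ideal.span (lc '' Set.Iio n), fun m n hmn =>
    Ideal.span_mono (Set.image_mono (Set.Iio_subset_Iio hmn))⟩
  obtain ⟨n, hn⟩ := monotone_stabilizes_iff_noetherian.2 ‹_› K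
  have hlc : lc n ∈ Ideal.span (Set.range fun i : Fin n => lc i) := by
    have h1 : lc n ∈ K n := by
      rw [hn (n + 1) n.le_succ]
      exact Ideal.subset_span ⟨n, Nat.lt_succ_self n, rfl⟩
    refine Ideal.span_mono ?_ h1
    rintro _ ⟨i, hi, rfl⟩
    exact ⟨⟨i, hi⟩, rfl⟩
  obtain ⟨r, hr⟩ := Ideal.mem_span_range_iff_exists_fun.1 hlc
  choose g hg c hc hgc using fun i : Fin n => hdiv i n i.2
  let q : Fin n → T := fun i => ⟨monomial (c i) (r i), (hT _).2 fun m hm => by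
    rw [Finset.mem_singleton.1 (support_monomial_subset hm)]; exact hc i⟩
  let p : Fin n → T := fun i => ⟨rename (g i) (f (φ i) : MvPolynomial σ R),
    hstab _ (hg i) _ (f (φ i)).2⟩
  have hsum : ∑ i, q i * p i ∈ J (S (φ n)) := by
    refine Ideal.sum_mem _ fun i _ => Ideal.mul_mem_left _ _ (Ideal.subset_span ?_)
    exact ⟨f (φ i), hfS _ _ (hφ i.2), g i, hg i, rfl⟩
  have hnot : f (φ n) - ∑ i, q i * p i ∉ J (S (φ n)) := fun h =>
    hfJ (φ n) (by simpa using add_mem h hsum)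
  have hcoe : ((f (φ n) - ∑ i, q i * p i : T) : MvPolynomial σ R) =
      (f (φ n) : MvPolynomial σ R) -
        ∑ i, monomial (c i) (r i) * rename (g i) (f (φ i) : MvPolynomial σ R) := by
    simp [q, p]
  refine hfmin (φ n) _ (sub_mem (hfI _) (hJI _ (hSI _) hsum)) hnot ?_
  change ord.toSyn (ord.degree _) < _
  rw [hcoe]
  refine toSyn_degree_sub_sum_lt ord _ r g c (fun i => hinj _ (hg i)) (fun i => hord _ (hg i))
    hgc hr.symm ?_
  rw [← hcoe]
  intro h
  rw [ZeroMemClass.coe_eq_zero] at h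
  exact hnot (by rw [h]; exact zero_mem _)

/-- Membership in the subalgebra generated by monomials is detected on exponents. -/
theorem mem_adjoin_monomials_iff {σ R : Type*} [CommRing R] (s : Set (σ →₀ ℕ))
    (f : MvPolynomial σ R) :
    f ∈ Algebra.adjoin R ((fun m => monomial m (1 : R)) '' s) ↔
      ∀ m ∈ f.support, m ∈ AddSubmonoid.closure s := by
  classical
  constructor
  · intro hf
    induction hf using Algebra.adjoin_induction with
    | mem x hx =>
      obtain ⟨m, hm, rfl⟩ := hx
      intro n hn
      rw [Finset.mem_singleton.1 (support_monomial_subset hn)]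
      exact AddSubmonoid.subset_closure hm
    | algebraMap r =>
      intro n hn
      rw [MvPolynomial.algebraMap_eq, C_apply] at hn
      rw [Finset.mem_singleton.1 (support_monomial_subset hn)]
      exact zero_mem _
    | add x y _ _ hx hy =>
      intro n hn
      exact (Finset.mem_union.1 (support_add hn)).elim (hx n) (hy n)
    | mul x y _ _ hx hy =>
      intro n hn
      obtain ⟨a, ha, b, hb, rfl⟩ := Finset.mem_add.1 (support_mul x y hn)
      exact add_mem (hx a ha) (hy b hb)
  · intro hf
    have hmon : ∀ m ∈ AddSubmonoid.closure s,
        monomial m (1 : R) ∈ Algebra.adjoin R ((fun m => monomial m (1 : R)) '' s) := by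
      intro m hm
      induction hm using AddSubmonoid.closure_induction with
      | mem x hx => exact Algebra.subset_adjoin ⟨x, hx, rfl⟩
      | zero => exact one_mem _
      | add x y _ _ hx hy =>
        have := mul_mem hx hy
        rwa [monomial_mul, one_mul] at this
    rw [f.as_sum]
    refine sum_mem fun m hm => ?_
    rw [← mul_one (coeff m f), ← smul_eq_mul, ← smul_monomial]
    exact Subalgebra.smul_mem _ (hmon m (hf m hm)) _

end MvPolynomial

/-- Some monomial order on the variables `x_{i,j}` is compatible with all strictly increasing
reindexings of the second index. -/
theorem exists_monomialOrder_mapDomain_lt (k : ℕ) :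
    ∃ ord : MonomialOrder.{0, 0} (Fin k × ℕ), ∀ π : ℕ → ℕ, StrictMono π → ∀ a b,
      ord.toSyn a < ord.toSyn b →
        ord.toSyn (a.mapDomain fun q : Fin k × ℕ => (q.1, π q.2)) <
          ord.toSyn (b.mapDomain fun q : Fin k × ℕ => (q.1, π q.2)) := by
  let e : Fin k × ℕ → (ℕ ×ₗ Fin k)ᵒᵈ := fun q => OrderDual.toDual (toLex (q.2, q.1))
  have he : Function.Injective e := by
    rintro ⟨a, b⟩ ⟨c, d⟩ h
    have h' := congrArg (fun x => ofLex (OrderDual.ofDual x)) h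
    simp only [e, OrderDual.ofDual_toDual, ofLex_toLex, Prod.mk.injEq] at h'
    rw [h'.1, h'.2]
  let lo : LinearOrder (Fin k × ℕ) := LinearOrder.lift' e he
  have hlt : ∀ p q : Fin k × ℕ, lo.lt p q ↔ q.2 < p.2 ∨ q.2 = p.2 ∧ q.1 < p.1 := fun p q =>
    Prod.Lex.toLex_lt_toLex
  have wf : @WellFoundedGT (Fin k × ℕ) lo.toLT :=
    ⟨(InvImage.wf e (wellFounded_gt (α := (ℕ ×ₗ Fin k)ᵒᵈ)))⟩
  refine ⟨@MonomialOrder.lex _ lo wf, fun π hπ a b hab => ?_⟩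
  have hinj : Function.Injective fun q : Fin k × ℕ => (q.1, π q.2) := by
    rintro ⟨a, b⟩ ⟨c, d⟩ h
    simpa [hπ.injective.eq_iff] using h
  obtain ⟨i, hi, hlti⟩ := hab
  refine ⟨(i.1, π i.2), fun j hj => ?_, ?_⟩
  · change a.mapDomain _ j = b.mapDomain _ j
    by_cases hr : j ∈ Set.range fun q : Fin k × ℕ => (q.1, π q.2)
    · obtain ⟨q, rfl⟩ := hr
      rw [Finsupp.mapDomain_apply hinj, Finsupp.mapDomain_apply hinj]
      refine hi q ((hlt _ _).2 ?_)
      simpa [hπ.lt_iff_lt, hπ.injective.eq_iff] using (hlt _ _).1 hj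
    · rw [Finsupp.mapDomain_of_notMem_range _ _ hr, Finsupp.mapDomain_of_notMem_range _ _ hr]
  · change a.mapDomain _ _ < b.mapDomain _ _
    rw [show (i.1, π i.2) = (fun q : Fin k × ℕ => (q.1, π q.2)) i from rfl,
      Finsupp.mapDomain_apply hinj, Finsupp.mapDomain_apply hinj]
    exact hlti

section Matchings

open Finset

/-- **König's theorem** for regular bipartite multigraphs: a natural-number matrix with all row and
column sums equal to some `D > 0` has a positive transversal. -/
theorem exists_injective_pos_of_sums_eq {X Y : Type*} [Fintype X] [Fintype Y] (M : X → Y → ℕ)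
    {D : ℕ} (hD : 0 < D) (hrow : ∀ x, ∑ y, M x y = D) (hcol : ∀ y, ∑ x, M x y = D) :
    ∃ f : X → Y, Function.Injective f ∧ ∀ x, 0 < M x (f x) := by
  classical
  obtain ⟨f, hf, hpos⟩ := (Finset.all_card_le_biUnion_card_iff_exists_injective
    (fun x => univ.filter fun y => 0 < M x y)).1 fun s => by
      refine Nat.le_of_mul_le_mul_right ?_ hD
      calc #s * D = ∑ x ∈ s, ∑ y, M x y := by simp [hrow]
        _ = ∑ x ∈ s, ∑ y ∈ s.biUnion (fun x => univ.filter fun y => 0 < M x y), M x y := by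
          refine sum_congr rfl fun x hx => (sum_subset (subset_univ _) fun y _ hy => ?_).symm
          by_contra h
          exact hy (mem_biUnion.2 ⟨x, hx, mem_filter.2 ⟨mem_univ _, Nat.pos_of_ne_zero h⟩⟩)
        _ = ∑ y ∈ s.biUnion (fun x => univ.filter fun y => 0 < M x y), ∑ x ∈ s, M x y :=
          sum_comm
        _ ≤ ∑ y ∈ s.biUnion (fun x => univ.filter fun y => 0 < M x y), ∑ x, M x y :=
          sum_le_sum fun y _ => sum_le_sum_of_subset (subset_univ _)
        _ = _ := by simp [hcol]
  exact ⟨f, hf, fun x => (mem_filter.1 (hpos x)).2⟩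

/-- A rectangular matrix with row sums `D` and column sums at most `D` has a positive transversal
meeting each column whose sum is exactly `D`. -/
theorem exists_injective_pos_of_sums_le {X Y : Type*} [Fintype X] [Fintype Y] (A : X → Y → ℕ)
    {D : ℕ} (hD : 0 < D) (hrow : ∀ x, ∑ y, A x y = D) (hcol : ∀ y, ∑ x, A x y ≤ D) :
    ∃ f : X → Y, Function.Injective f ∧ (∀ x, 0 < A x (f x)) ∧
      ∀ y, ∑ x, A x y = D → ∃ x, f x = y := by
  classical
  let M : X ⊕ Y → Y ⊕ X → ℕ := fun p q => match p, q with
    | .inl x, .inl y => A x y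
    | .inl _, .inr _ => 0
    | .inr y', .inl y => if y' = y then D - ∑ x, A x y else 0
    | .inr y', .inr x => A x y'
  obtain ⟨f, hf, hpos⟩ := exists_injective_pos_of_sums_eq M hD
    (by
      rintro (x | y)
      · simp [M, hrow]
      · simp [M, Nat.sub_add_cancel (hcol y)])
    (by
      rintro (y | x)
      · simp [M, Nat.add_sub_cancel' (hcol y)]
      · simp [M, hrow])
  have hl : ∀ x, ∃ y, f (.inl x) = .inl y := by
    intro x
    rcases h : f (.inl x) with y | x'
    · exact ⟨y, rfl⟩
    · have := hpos (.inl x)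
      simp [h, M] at this
  choose g hg using hl
  refine ⟨g, fun a b hab => ?_, fun x => ?_, fun y hy => ?_⟩
  · exact Sum.inl_injective (hf (by rw [hg, hg, hab]))
  · have := hpos (.inl x)
    rwa [hg] at this
  · have hsurj : Function.Surjective f :=
      ((Fintype.bijective_iff_injective_and_card f).2 ⟨hf, by simp [add_comm]⟩).2
    obtain ⟨x | y', h⟩ := hsurj (.inl y)
    · exact ⟨x, Sum.inl_injective (by rw [← hg, h])⟩
    · have := hpos (.inr y')
      simp only [h, M] at this
      split_ifs at this <;> omega

/-- A family of `w` finitely supported rows all of whose row sums are `d` and all of whose column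
sums are at most `d`; equivalently, a sum of `d` injections `Fin w → ℕ`. -/
def IsBalanced {w : ℕ} (d : ℕ) (A : Fin w → ℕ →₀ ℕ) : Prop :=
  (∀ l, (A l).degree = d) ∧ ∀ j, ∑ l, A l j ≤ d

theorem IsBalanced.add {w d e : ℕ} {A B : Fin w → ℕ →₀ ℕ} (hA : IsBalanced d A)
    (hB : IsBalanced e B) : IsBalanced (d + e) (A + B) := by
  refine ⟨fun l => by simp [hA.1 l, hB.1 l], fun j => ?_⟩
  simpa [Finset.sum_add_distrib] using add_le_add (hA.2 j) (hB.2 j)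

theorem IsBalanced.zero {w : ℕ} : IsBalanced 0 (0 : Fin w → ℕ →₀ ℕ) :=
  ⟨fun _ => by simp, fun _ => by simp⟩

theorem IsBalanced.single {w : ℕ} (f : Fin w → ℕ) (hf : Function.Injective f) :
    IsBalanced 1 (fun l => Finsupp.single (f l) 1) := by
  classical
  refine ⟨fun l => by simp, fun j => ?_⟩
  simp only [Finsupp.single_apply, sum_boole, Nat.cast_id]
  exact card_le_one.2 fun a ha b hb =>
    hf ((mem_filter.1 ha).2.trans (mem_filter.1 hb).2.symm)

theorem IsBalanced.mapDomain {w d : ℕ} {A : Fin w → ℕ →₀ ℕ} (hA : IsBalanced d A) {π : ℕ → ℕ}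
    (hπ : Function.Injective π) : IsBalanced d fun l => (A l).mapDomain π := by
  refine ⟨fun l => by rw [Finsupp.degree_mapDomain, hA.1 l], fun j => ?_⟩
  by_cases hj : j ∈ Set.range π
  · obtain ⟨j, rfl⟩ := hj
    simpa [Finsupp.mapDomain_apply hπ] using hA.2 j
  · simp [Finsupp.mapDomain_of_notMem_range _ _ hj]

/-- A balanced family is a sum of a single injection and a balanced family. -/
theorem IsBalanced.exists_eq_single_add {w d : ℕ} {A : Fin w → ℕ →₀ ℕ}
    (hA : IsBalanced (d + 1) A) :
    ∃ (f : Fin w → ℕ) (B : Fin w → ℕ →₀ ℕ), Function.Injective f ∧ IsBalanced d B ∧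
      A = (fun l => Finsupp.single (f l) 1) + B := by
  classical
  let s : Finset ℕ := univ.biUnion fun l => (A l).support
  have hs : ∀ l, (A l).support ⊆ s := fun l => subset_biUnion_of_mem (fun l => (A l).support)
    (mem_univ l)
  obtain ⟨f, hf, hpos, hfull⟩ := exists_injective_pos_of_sums_le
    (fun (l : Fin w) (j : s) => A l j) (D := d + 1) (Nat.succ_pos d)
    (fun l => by
      rw [← hA.1 l, Finsupp.degree_apply, Finset.sum_coe_sort s (fun j => A l j)]
      exact (sum_subset (hs l) fun j _ hj => by simpa using hj).symm)
    (fun j => hA.2 j)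
  have hle : ∀ l, Finsupp.single (f l : ℕ) 1 ≤ A l := fun l =>
    Finsupp.single_le_iff.2 (hpos l)
  have hadd : A = (fun l => Finsupp.single (f l : ℕ) 1) +
      fun l => A l - Finsupp.single (f l : ℕ) 1 := by
    funext l
    exact (add_tsub_cancel_of_le (hle l)).symm
  refine ⟨fun l => f l, fun l => A l - Finsupp.single (f l : ℕ) 1,
    Subtype.val_injective.comp hf, ⟨fun l => ?_, fun j => ?_⟩, hadd⟩
  · have h1 := hA.1 l
    rw [← add_tsub_cancel_of_le (hle l), map_add, Finsupp.degree_single] at h1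
    change (A l - Finsupp.single (f l : ℕ) 1).degree = d
    omega
  · change ∑ l, (A l - Finsupp.single (f l : ℕ) 1 : ℕ →₀ ℕ) j ≤ d
    have h2 : ∑ l, (A l - Finsupp.single (f l : ℕ) 1 : ℕ →₀ ℕ) j ≤ ∑ l, A l j :=
      sum_le_sum fun l _ => by simp
    rcases (hA.2 j).lt_or_eq with h | h
    · omega
    · have hj : j ∈ s := by
        by_contra hj
        have h0 : ∑ l, A l j = 0 := sum_eq_zero fun l _ =>
          Finsupp.notMem_support_iff.1 fun h => hj (hs l h)
        omega
      obtain ⟨l, hl⟩ := hfull ⟨j, hj⟩ h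
      refine Nat.le_of_lt_succ (lt_of_lt_of_eq (sum_lt_sum (fun l _ => by simp)
        ⟨l, mem_univ l, ?_⟩) h)
      have := hpos l
      simp only [hl] at this ⊢
      simpa using this

/-- The image of a family of rows under the substitution sending the variable in row `l` and
column `j` to `∏ q, x_{q,j} ^ m (q, l)`, on the level of exponents. -/
noncomputable def substExp {k w : ℕ} (m : Fin k × ℕ →₀ ℕ) :
    (Fin w → ℕ →₀ ℕ) →+ (Fin k × ℕ →₀ ℕ) where
  toFun A := ∑ l : Fin w, ∑ q, m (q, l) • (A l).mapDomain (fun j => (q, j))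
  map_zero' := by simp
  map_add' A B := by simp [Finsupp.mapDomain_add, sum_add_distrib]

theorem substExp_single {k w : ℕ} (m : Fin k × ℕ →₀ ℕ) (hm : ∀ p ∈ m.support, p.2 < w)
    (τ : ℕ → ℕ) :
    substExp m (fun l : Fin w => Finsupp.single (τ l) 1) =
      m.mapDomain fun q => (q.1, τ q.2) := by
  classical
  rw [Finsupp.mapDomain, Finsupp.sum_of_support_subset m
    (s := univ ×ˢ range w) (fun p hp => by simpa using hm p hp) _ (by simp),
    sum_product_right, ← Fin.sum_univ_eq_sum_range
      (fun l => ∑ q, Finsupp.single (q, τ l) (m (q, l)))]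
  simp [substExp]

theorem substExp_mapDomain {k w : ℕ} (m : Fin k × ℕ →₀ ℕ) (A : Fin w → ℕ →₀ ℕ) (π : ℕ → ℕ) :
    substExp m (fun l => (A l).mapDomain π) =
      (substExp m A).mapDomain fun q => (q.1, π q.2) := by
  change _ = Finsupp.mapDomain.addMonoidHom (fun q : Fin k × ℕ => (q.1, π q.2)) _
  simp only [substExp, AddMonoidHom.coe_mk, ZeroHom.coe_mk, map_sum, map_nsmul]
  refine sum_congr rfl fun l _ => sum_congr rfl fun q _ => ?_
  simp only [Finsupp.mapDomain.addMonoidHom, AddMonoidHom.coe_mk, ZeroHom.coe_mk,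
    ← Finsupp.mapDomain_comp]
  rfl

/-- An injection on finitely many columns acts on an exponent like some permutation. -/
theorem exists_perm_mapDomain_eq {k w : ℕ} (m : Fin k × ℕ →₀ ℕ) (hm : ∀ p ∈ m.support, p.2 < w)
    (f : Fin w → ℕ) (hf : Function.Injective f) :
    ∃ σ : Equiv.Perm ℕ, substExp m (fun l : Fin w => Finsupp.single (f l) 1) =
      m.mapDomain fun q => (q.1, σ q.2) := by
  obtain ⟨σ, hσ⟩ := MulAction.isMultiplyPretransitive_iff.1
    (Equiv.Perm.isMultiplyPretransitive ℕ w) Fin.valEmbedding ⟨f, hf⟩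
  refine ⟨σ, ?_⟩
  rw [← substExp_single m hm]
  congr! 3 with l
  exact (DFunLike.congr_fun hσ l).symm

theorem IsBalanced.substExp_mem {k w d : ℕ} {m : Fin k × ℕ →₀ ℕ}
    (hm : ∀ p ∈ m.support, p.2 < w) {M : AddSubmonoid (Fin k × ℕ →₀ ℕ)}
    (hM : ∀ σ : Equiv.Perm ℕ, (m.mapDomain fun q => (q.1, σ q.2)) ∈ M)
    {A : Fin w → ℕ →₀ ℕ} (hA : IsBalanced d A) : substExp m A ∈ M := by
  induction d generalizing A with
  | zero =>
    have : A = 0 := funext fun l => (Finsupp.degree_eq_zero_iff _).1 (hA.1 l)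
    rw [this, map_zero]
    exact zero_mem _
  | succ d ih =>
    obtain ⟨f, B, hf, hB, rfl⟩ := hA.exists_eq_single_add
    obtain ⟨σ, hσ⟩ := exists_perm_mapDomain_eq m hm f hf
    rw [map_add, hσ]
    exact add_mem (hM σ) (ih hB)

theorem exists_isBalanced_of_mem_closure {ι : Type*} [Fintype ι] {k w : ℕ}
    (m : ι → Fin k × ℕ →₀ ℕ) (hm : ∀ i, ∀ p ∈ (m i).support, p.2 < w) {x : Fin k × ℕ →₀ ℕ}
    (hx : x ∈ AddSubmonoid.closure
      {y | ∃ i, ∃ σ : Equiv.Perm ℕ, y = (m i).mapDomain fun q => (q.1, σ q.2)}) :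
    ∃ (d : ι → ℕ) (A : ι → Fin w → ℕ →₀ ℕ), (∀ i, IsBalanced (d i) (A i)) ∧
      x = ∑ i, substExp (m i) (A i) := by
  classical
  induction hx using AddSubmonoid.closure_induction with
  | mem y hy =>
    obtain ⟨i, σ, rfl⟩ := hy
    refine ⟨Pi.single i 1, Pi.single i fun l => Finsupp.single (σ l) 1, fun i' => ?_, ?_⟩
    · by_cases h : i' = i
      · subst h
        simpa using IsBalanced.single _ (σ.injective.comp Fin.val_injective)
      · simpa [h] using IsBalanced.zero
    · rw [sum_eq_single i (fun i' _ h => by simp [h]) (by simp), Pi.single_eq_same,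
        substExp_single _ (hm i)]
  | zero => exact ⟨0, 0, fun _ => IsBalanced.zero, by simp⟩
  | add x y _ _ hx hy =>
    obtain ⟨d, A, hA, rfl⟩ := hx
    obtain ⟨e, B, hB, rfl⟩ := hy
    exact ⟨d + e, A + B, fun i => (hA i).add (hB i), by simp [sum_add_distrib]⟩

/-- A criterion for the difference of two balanced families to be balanced. -/
theorem IsBalanced.exists_eq_mapDomain_add {w d e N : ℕ} {A B : Fin w → ℕ →₀ ℕ}
    (hA : IsBalanced d A) (hB : IsBalanced e B) {π : ℕ → ℕ} (hπ : Function.Injective π)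
    (hN : ∀ l j, N ≤ j → A l j = 0) (hle : ∀ l, ∀ j < N, A l j ≤ B l (π j))
    (hslack : ∀ j < N, d - ∑ l, A l j ≤ e - ∑ l, B l (π j)) (hde : d = e ∨ 2 * d ≤ e)
    (hbig : ∀ j, e < 2 * ∑ l, B l j → ∃ i < N, π i = j) :
    ∃ C : Fin w → ℕ →₀ ℕ, IsBalanced (e - d) C ∧ B = (fun l => (A l).mapDomain π) + C := by
  have hle' : ∀ l, (A l).mapDomain π ≤ B l := by
    intro l j
    by_cases hj : j ∈ Set.range π
    · obtain ⟨j, rfl⟩ := hj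
      rw [Finsupp.mapDomain_apply hπ]
      rcases lt_or_ge j N with h | h
      · exact hle l j h
      · simp [hN l j h]
    · simp [Finsupp.mapDomain_of_notMem_range _ _ hj]
  have hadd : B = (fun l => (A l).mapDomain π) + fun l => B l - (A l).mapDomain π :=
    funext fun l => (add_tsub_cancel_of_le (hle' l)).symm
  have hdeg : ∀ l, (B l - (A l).mapDomain π).degree = e - d := by
    intro l
    have h := hB.1 l
    rw [← add_tsub_cancel_of_le (hle' l), map_add, Finsupp.degree_mapDomain, hA.1 l] at h
    omega
  refine ⟨_, ⟨hdeg, fun j => ?_⟩, hadd⟩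
  rcases hde with rfl | hde
  · refine (sum_eq_zero fun l _ => ?_).le.trans (Nat.zero_le _)
    have h := hdeg l
    rw [Nat.sub_self, Finsupp.degree_eq_zero_iff] at h
    rw [h]; rfl
  by_cases hj : ∃ i < N, π i = j
  · obtain ⟨i, hi, rfl⟩ := hj
    have h1 : ∑ l, (B l - (A l).mapDomain π) (π i) + ∑ l, A l i = ∑ l, B l (π i) := by
      rw [← sum_add_distrib]
      refine sum_congr rfl fun l _ => ?_
      rw [Finsupp.tsub_apply, Finsupp.mapDomain_apply hπ, Nat.sub_add_cancel (hle l i hi)]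
    have h2 := hslack i hi
    have h3 := hA.2 i
    have h4 := hB.2 (π i)
    omega
  · have h1 : ∑ l, (B l - (A l).mapDomain π) j ≤ ∑ l, B l j :=
      sum_le_sum fun l _ => by simp
    have h2 : ¬ e < 2 * ∑ l, B l j := fun h => hj (hbig j h)
    omega

/-- Only boundedly many columns can carry more than half of the common row sum. -/
theorem IsBalanced.card_le {w d : ℕ} {A : Fin w → ℕ →₀ ℕ} (hA : IsBalanced d A) (s : Finset ℕ)
    (hs : ∀ j ∈ s, d < 2 * ∑ l, A l j) : #s ≤ 2 * w := by
  have h1 : ∑ j ∈ s, ∑ l, A l j ≤ w * d := by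
    rw [sum_comm]
    calc ∑ l, ∑ j ∈ s, A l j ≤ ∑ l : Fin w, d := sum_le_sum fun l _ => by
          rw [← hA.1 l, Finsupp.degree_apply]
          exact sum_le_sum_of_ne_zero fun j _ hj => Finsupp.mem_support_iff.2 hj
      _ = w * d := by simp
  have h2 : #s * (d + 1) ≤ ∑ j ∈ s, 2 * ∑ l, A l j := by
    simpa using card_nsmul_le_sum s (fun j => 2 * ∑ l, A l j) (d + 1) hs
  rw [← mul_sum] at h2
  refine Nat.le_of_mul_le_mul_right (c := d + 1) ?_ (Nat.succ_pos d)
  nlinarith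

theorem wellQuasiOrdered_eq_or_two_mul_le :
    WellQuasiOrdered fun a b : ℕ => a = b ∨ 2 * a ≤ b := by
  intro f
  by_cases h : ∃ n, 0 < n ∧ 2 * f 0 ≤ f n
  · obtain ⟨n, hn, h⟩ := h
    exact ⟨0, n, hn, Or.inr h⟩
  · push Not at h
    obtain ⟨m, n, hmn, h⟩ := (Set.finite_Iio (2 * f 0)).exists_lt_map_eq_of_forall_mem
      (f := fun n => f (n + 1)) fun n => h _ n.succ_pos
    exact ⟨m + 1, n + 1, by omega, Or.inl h⟩

instance isPreorder_eq_or_two_mul_le : IsPreorder ℕ fun a b : ℕ => a = b ∨ 2 * a ≤ b where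
  refl _ := Or.inl rfl
  trans _ _ _ h₁ h₂ := by omega

theorem IsPreorder.prod {α β : Type*} {r : α → α → Prop} {s : β → β → Prop}
    [IsPreorder α r] [IsPreorder β s] :
    IsPreorder (α × β) fun a b => r a.1 b.1 ∧ s a.2 b.2 where
  refl a := ⟨refl_of r a.1, refl_of s a.2⟩
  trans _ _ _ h₁ h₂ := ⟨trans_of r h₁.1 h₂.1, trans_of s h₁.2 h₂.2⟩

theorem IsPreorder.pi {ι : Type*} {α : ι → Type*} {r : ∀ i, α i → α i → Prop}
    [∀ i, IsPreorder (α i) (r i)] :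
    IsPreorder (∀ i, α i) fun a b => ∀ i, r i (a i) (b i) where
  refl a i := refl_of (r i) (a i)
  trans _ _ _ h₁ h₂ i := trans_of (r i) (h₁ i) (h₂ i)

/-- **Higman's lemma** for sequences of finite words, with the embeddings given by strictly
increasing maps. -/
theorem WellQuasiOrdered.exists_subseq_word_embedding {α : Type*} {r : α → α → Prop}
    [IsPreorder α r] (hr : WellQuasiOrdered r) (N : ℕ → ℕ) (u : ℕ → ℕ → α) :
    ∃ φ : ℕ → ℕ, StrictMono φ ∧ ∀ a b, a < b → ∃ π : ℕ → ℕ, StrictMono π ∧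
      ∀ j < N (φ a), π j < N (φ b) ∧ r (u (φ a) j) (u (φ b) (π j)) := by
  have hhig : WellQuasiOrdered (List.SublistForall₂ r) := by
    have h := Set.PartiallyWellOrderedOn.partiallyWellOrderedOn_sublistForall₂ r
      (Set.partiallyWellOrderedOn_univ_iff.2 hr)
    exact Set.partiallyWellOrderedOn_univ_iff.1 (by simpa using h)
  have : IsPreorder (List α) (List.SublistForall₂ r) := {}
  obtain ⟨φ, hφ⟩ := hhig.exists_monotone_subseq fun n => (List.range (N n)).map (u n)
  refine ⟨φ, φ.strictMono, fun a b hab => ?_⟩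
  obtain ⟨l, hl, hsub⟩ := List.sublistForall₂_iff.1 (hφ a b hab.le)
  obtain ⟨π, hπ⟩ := List.sublist_iff_exists_orderEmbedding_getElem?_eq.1 hsub
  refine ⟨π, π.strictMono, fun j hj => ?_⟩
  have hlen : j < l.length := by simpa [← hl.length_eq] using hj
  have h1 := hπ j
  rw [List.getElem?_eq_getElem hlen] at h1
  obtain ⟨h2, h3⟩ := List.getElem?_eq_some_iff.1 h1.symm
  have h4 := hl.get (i := j) (by simpa using hj) hlen
  refine ⟨by simpa using h2, ?_⟩
  simp only [List.getElem_map, List.getElem_range] at h3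
  rw [h3]
  simpa using h4

/-- Finite tuples of balanced families are well-quasi-ordered by divisibility up to strictly
increasing relabelling of the columns. -/
theorem IsBalanced.exists_subseq {ι : Type*} [Finite ι] {w : ℕ} (d : ℕ → ι → ℕ)
    (A : ℕ → ι → Fin w → ℕ →₀ ℕ) (hA : ∀ n i, IsBalanced (d n i) (A n i)) :
    ∃ φ : ℕ → ℕ, StrictMono φ ∧ ∀ a b, a < b → ∃ π : ℕ → ℕ, StrictMono π ∧
      ∀ i, ∃ (e : ℕ) (C : Fin w → ℕ →₀ ℕ), IsBalanced e C ∧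
        A (φ b) i = (fun l => (A (φ a) i l).mapDomain π) + C := by
  classical
  have := Fintype.ofFinite ι
  have hN : ∀ n, ∃ N, ∀ i l j, N ≤ j → A n i l j = 0 := by
    intro n
    let s : Finset ℕ := univ.biUnion fun i => univ.biUnion fun l => (A n i l).support
    refine ⟨s.sup id + 1, fun i l j hj => ?_⟩
    by_contra h
    have hs : j ∈ s := mem_biUnion.2 ⟨i, mem_univ i, mem_biUnion.2
      ⟨l, mem_univ l, Finsupp.mem_support_iff.2 h⟩⟩
    have := le_sup (f := id) hs
    simp only [id] at this
    omega
  choose N hN using hN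
  let big : ℕ → ι → Finset ℕ := fun n i =>
    (range (N n)).filter fun j => d n i < 2 * ∑ l, A n i l j
  have hbig : ∀ n i j, j ∈ big n i ↔ d n i < 2 * ∑ l, A n i l j := by
    intro n i j
    refine ⟨fun h => (mem_filter.1 h).2, fun h => mem_filter.2 ⟨mem_range.2 ?_, h⟩⟩
    by_contra hj
    have h0 : ∑ l, A n i l j = 0 := sum_eq_zero fun l _ => hN n i l j (not_lt.1 hj)
    omega
  have hcard : ∀ n i, #(big n i) < 2 * w + 1 := fun n i =>
    Nat.lt_succ_of_le ((hA n i).card_le _ fun j hj => (hbig n i j).1 hj)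
  -- Make the row sums comparable and the number of large columns constant.
  have hglob : WellQuasiOrdered fun a b : ι → ℕ × Fin (2 * w + 1) =>
      ∀ i, ((a i).1 = (b i).1 ∨ 2 * (a i).1 ≤ (b i).1) ∧ (a i).2 = (b i).2 := by
    have := IsPreorder.prod (r := fun a b : ℕ => a = b ∨ 2 * a ≤ b)
      (s := fun a b : Fin (2 * w + 1) => a = b)
    exact WellQuasiOrdered.pi fun _ =>
      wellQuasiOrdered_eq_or_two_mul_le.prod (Finite.wellQuasiOrdered _)
  have : IsPreorder (ι → ℕ × Fin (2 * w + 1)) fun a b =>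
      ∀ i, ((a i).1 = (b i).1 ∨ 2 * (a i).1 ≤ (b i).1) ∧ (a i).2 = (b i).2 := by
    have := IsPreorder.prod (r := fun a b : ℕ => a = b ∨ 2 * a ≤ b)
      (s := fun a b : Fin (2 * w + 1) => a = b)
    exact IsPreorder.pi (ι := ι) (r := fun _ (a b : ℕ × Fin (2 * w + 1)) =>
      (a.1 = b.1 ∨ 2 * a.1 ≤ b.1) ∧ a.2 = b.2)
  obtain ⟨ψ, hψ⟩ := hglob.exists_monotone_subseq fun n i => (d n i, ⟨#(big n i), hcard n i⟩)
  -- Embed the words of columns, remembering slacks and large columns.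
  have hlab : WellQuasiOrdered fun a b : ((ι → Fin w → ℕ) × (ι → ℕ)) × (ι → Prop) =>
      a.1 ≤ b.1 ∧ a.2 = b.2 :=
    wellQuasiOrdered_le.prod (Finite.wellQuasiOrdered _)
  have := IsPreorder.prod (r := fun a b : (ι → Fin w → ℕ) × (ι → ℕ) => a ≤ b)
    (s := fun a b : ι → Prop => a = b)
  obtain ⟨χ, hχ, hemb⟩ := hlab.exists_subseq_word_embedding (fun n => N (ψ n)) fun n j =>
    ((fun i l => A (ψ n) i l j, fun i => d (ψ n) i - ∑ l, A (ψ n) i l j),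
      fun i => j ∈ big (ψ n) i)
  refine ⟨fun n => ψ (χ n), ψ.strictMono.comp hχ, fun a b hab => ?_⟩
  obtain ⟨π, hπ, hlabel⟩ := hemb a b hab
  refine ⟨π, hπ, fun i => ?_⟩
  have hg := hψ _ _ (hχ hab).le i
  refine ⟨_, (hA _ i).exists_eq_mapDomain_add (hA _ i) hπ.injective (fun l j hj => hN _ i l j hj)
    (fun l j hj => (hlabel j hj).2.1.1 i l) (fun j hj => (hlabel j hj).2.1.2 i) hg.1
    fun j hj => ?_⟩
  have hsub : (big (ψ (χ a)) i).image π ⊆ big (ψ (χ b)) i := by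
    intro x hx
    obtain ⟨y, hy, rfl⟩ := mem_image.1 hx
    have hyN := mem_range.1 (mem_filter.1 hy).1
    exact (congrFun (hlabel y hyN).2.2 i).mp hy
  have heq := eq_of_subset_of_card_le hsub (by
    rw [card_image_of_injective _ hπ.injective]
    exact (congrArg Fin.val hg.2).ge)
  rw [← hbig, ← heq] at hj
  obtain ⟨y, hy, rfl⟩ := mem_image.1 hj
  exact ⟨y, mem_range.1 (mem_filter.1 hy).1, rfl⟩

end Matchings

open MvPolynomial

/-- Let `R` be Noetherian and let `T` be the `R`-subalgebra of `R[X]`, `X = [k] × ℕ`,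
generated by the union of the `Sym(ℕ)`-orbits of finitely many monomials `u ∈ U`.  Then
`T` is stable under the `Inc(ℕ)`-action on `R[X]`, and `T` is `Inc(ℕ)`-Noetherian: every
`Inc(ℕ)`-stable ideal of `T` is generated by the union of finitely many `Inc(ℕ)`-orbits
of its elements. -/
theorem symOrbit_monomial_subalgebra_noetherian
    {R : Type} [CommRing R] [IsNoetherianRing R] (k : ℕ)
    (U : Finset (MvPolynomial (Fin k × ℕ) R))
    (hU : ∀ u ∈ U, ∃ m : Fin k × ℕ →₀ ℕ, u = monomial m 1)
    (T : Subalgebra R (MvPolynomial (Fin k × ℕ) R))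
    (hT : T = Algebra.adjoin R {g | ∃ u ∈ U, ∃ σ : Equiv.Perm ℕ,
      g = rename (fun q : Fin k × ℕ => (q.1, σ q.2)) u}) :
    (∀ (π : ℕ → ℕ), StrictMono π → ∀ f ∈ T,
        rename (fun q : Fin k × ℕ => (q.1, π q.2)) f ∈ T) ∧
    ∀ I : Ideal T,
      (∀ (π : ℕ → ℕ), StrictMono π → ∀ x ∈ I, ∀ y : T,
          (y : MvPolynomial (Fin k × ℕ) R) =
            rename (fun q : Fin k × ℕ => (q.1, π q.2))
              (x : MvPolynomial (Fin k × ℕ) R) → y ∈ I) →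
      ∃ F : Finset T, (↑F : Set T) ⊆ (I : Set T) ∧
        I = Ideal.span {g : T | ∃ f ∈ F, ∃ π : ℕ → ℕ, StrictMono π ∧
          (g : MvPolynomial (Fin k × ℕ) R) =
            rename (fun q : Fin k × ℕ => (q.1, π q.2))
              (f : MvPolynomial (Fin k × ℕ) R)} := by
  classical
  choose! e he using hU
  let m : U → Fin k × ℕ →₀ ℕ := fun u => e u
  let s : Set (Fin k × ℕ →₀ ℕ) :=
    {y | ∃ i, ∃ σ : Equiv.Perm ℕ, y = (m i).mapDomain fun q => (q.1, σ q.2)}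
  have hT' : ∀ f, f ∈ T ↔ ∀ n ∈ f.support, n ∈ AddSubmonoid.closure s := by
    intro f
    rw [← mem_adjoin_monomials_iff, hT]
    suffices h : {g | ∃ u ∈ U, ∃ σ : Equiv.Perm ℕ,
        g = rename (fun q : Fin k × ℕ => (q.1, σ q.2)) u} = (fun n => monomial n (1 : R)) '' s by
      rw [h]
    have hren : ∀ u ∈ U, ∀ σ : Equiv.Perm ℕ, rename (fun q : Fin k × ℕ => (q.1, σ q.2)) u =
        monomial ((e u).mapDomain fun q => (q.1, σ q.2)) 1 := by
      intro u hu σ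
      conv_lhs => rw [he u hu]
      exact rename_monomial _ _ _
    ext g
    constructor
    · rintro ⟨u, hu, σ, rfl⟩
      exact ⟨_, ⟨⟨u, hu⟩, σ, rfl⟩, (hren u hu σ).symm⟩
    · rintro ⟨_, ⟨⟨u, hu⟩, σ, rfl⟩, rfl⟩
      exact ⟨u, hu, σ, (hren u hu σ).symm⟩
  obtain ⟨w, hw⟩ : ∃ w, ∀ i, ∀ p ∈ (m i).support, p.2 < w := by
    refine ⟨(Finset.univ.biUnion fun i => (m i).support).sup Prod.snd + 1, fun i p hp =>
      Nat.lt_succ_of_le (Finset.le_sup (f := Prod.snd) ?_)⟩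
    exact Finset.mem_biUnion.2 ⟨i, Finset.mem_univ i, hp⟩
  have hclosed : ∀ {d : ℕ} (i : U) {A : Fin w → ℕ →₀ ℕ}, IsBalanced d A →
      substExp (m i) A ∈ AddSubmonoid.closure s := by
    intro d i A hA
    refine hA.substExp_mem (hw i) fun σ => AddSubmonoid.subset_closure ?_
    exact ⟨i, σ, rfl⟩
  have hstab : ∀ (π : ℕ → ℕ), StrictMono π → ∀ f ∈ T,
      rename (fun q : Fin k × ℕ => (q.1, π q.2)) f ∈ T := by
    intro π hπ f hf
    rw [hT'] at hf ⊢
    intro n hn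
    obtain ⟨x, rfl, hx⟩ := coeff_rename_ne_zero _ _ _ (mem_support_iff.1 hn)
    obtain ⟨d, A, hA, rfl⟩ :=
      exists_isBalanced_of_mem_closure m hw (hf x (mem_support_iff.2 hx))
    rw [Finsupp.mapDomain_finsetSum]
    refine sum_mem fun i _ => ?_
    rw [← substExp_mapDomain]
    exact hclosed i ((hA i).mapDomain hπ.injective)
  refine ⟨hstab, fun I hI => ?_⟩
  obtain ⟨ord, hord⟩ := exists_monomialOrder_mapDomain_lt k
  let G : Set (Fin k × ℕ → Fin k × ℕ) :=
    {g | ∃ π : ℕ → ℕ, StrictMono π ∧ g = fun q => (q.1, π q.2)}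
  obtain ⟨F, hF, hspan⟩ := exists_finset_eq_span_orbits ord (AddSubmonoid.closure s) T hT' G
    (by
      rintro _ ⟨π, hπ, rfl⟩ ⟨a, b⟩ ⟨c, d⟩ h
      simpa [hπ.injective.eq_iff] using h)
    (by rintro _ ⟨π, hπ, rfl⟩; exact hord π hπ)
    (by rintro _ ⟨π, hπ, rfl⟩; exact hstab π hπ)
    (by
      intro a ha
      choose d A hA ha using fun n => exists_isBalanced_of_mem_closure m hw (ha n)
      obtain ⟨φ, hφ, h⟩ := IsBalanced.exists_subseq d A hA
      refine ⟨φ, hφ, fun i j hij => ?_⟩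
      obtain ⟨π, hπ, h⟩ := h i j hij
      choose c C hC hadd using h
      refine ⟨_, ⟨π, hπ, rfl⟩, ∑ u, substExp (m u) (C u), sum_mem fun u _ => hclosed u (hC u), ?_⟩
      rw [ha, ha, Finsupp.mapDomain_finsetSum, ← Finset.sum_add_distrib]
      refine Finset.sum_congr rfl fun u _ => ?_
      rw [hadd, map_add, substExp_mapDomain])
    I (by rintro _ ⟨π, hπ, rfl⟩; exact hI π hπ)
  refine ⟨F, hF, hspan.trans (congrArg Ideal.span (Set.ext fun y => ?_))⟩
  constructor
  · rintro ⟨f, hf, _, ⟨π, hπ, rfl⟩, hy⟩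
    exact ⟨f, hf, π, hπ, hy⟩
  · rintro ⟨f, hf, π, hπ, hy⟩
    exact ⟨f, hf, _, ⟨π, hπ, rfl⟩, hy⟩
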